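/- arXiv:0911.3195 — 2 statements merged into one kernel-verified Lean document; each statement's English description precedes it below -/
import Mathlib

section
/- There exists a constant β > 0 such that the following holds. For every finite simple connected undirected graph G with m edges in which every vertex has degree at least 1, for every pair of vertices x, y and every natural number t with t ≤ β·m², the lazy simple random walk (X_0, …, X_t) of length t started at x satisfies Σ_{0 ≤ i < j ≤ t} Pr(X_i = y and X_j = y) ≤ 64·d(y)²·(t+1). -/
open Finset

section Defs

variable {V : Type} [Fintype V] [DecidableEq V]

/-- Transition kernel of the lazy simple random walk on `G`. -/
noncomputable def lazyStep (G : SimpleGraph V) [DecidableRel G.Adj] (u v : V) : ℝ :=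
  if u = v then 1 / 2 else if G.Adj u v then 1 / (2 * (G.degree u : ℝ)) else 0

/-- Law (probability mass function) of the lazy random walk of length `t` started at `x`,
as a function on trajectories `Fin (t+1) → V`. -/
noncomputable def lazyWalkLaw (G : SimpleGraph V) [DecidableRel G.Adj] (x : V) (t : ℕ)
    (f : Fin (t + 1) → V) : ℝ :=
  (if f 0 = x then 1 else 0) * ∏ i : Fin t, lazyStep G (f i.castSucc) (f i.succ)

/-- Probability of an event `E` of trajectories, under the lazy walk law. -/
noncomputable def lazyWalkPr (G : SimpleGraph V) [DecidableRel G.Adj] (x : V) (t : ℕ)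
    (E : Set (Fin (t + 1) → V)) : ℝ :=
  ∑ f : Fin (t + 1) → V, E.indicator (lazyWalkLaw G x t) f

/-- Expectation of a random variable `N` of the trajectory, under the lazy walk law. -/
noncomputable def lazyWalkExp (G : SimpleGraph V) [DecidableRel G.Adj] (x : V) (t : ℕ)
    (N : (Fin (t + 1) → V) → ℝ) : ℝ :=
  ∑ f : Fin (t + 1) → V, lazyWalkLaw G x t f * N f

/-- Number of indices `0 ≤ i ≤ t` at which the trajectory `f` visits `y`. -/
def visits (y : V) {t : ℕ} (f : Fin (t + 1) → V) : ℕ :=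
  (Finset.univ.filter fun i => f i = y).card

end Defs

section Aux

variable {V : Type} [Fintype V] [DecidableEq V]

/-- Transition matrix of the lazy walk. -/
noncomputable def lazyMat (G : SimpleGraph V) [DecidableRel G.Adj] : Matrix V V ℝ :=
  Matrix.of (lazyStep G)

theorem lazyMat_apply (G : SimpleGraph V) [DecidableRel G.Adj] (u v : V) :
    lazyMat G u v = lazyStep G u v := rfl

theorem lazyStep_nonneg (G : SimpleGraph V) [DecidableRel G.Adj] (u v : V) :
    0 ≤ lazyStep G u v := by
  unfold lazyStep
  split_ifs <;> positivity

theorem lazyStep_sum (G : SimpleGraph V) [DecidableRel G.Adj] (hd : ∀ v, 1 ≤ G.degree v)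
    (u : V) : ∑ v, lazyStep G u v = 1 := by
  have h : ∀ v, lazyStep G u v = (if u = v then 1 / 2 else 0) +
      (if G.Adj u v then 1 / (2 * (G.degree u : ℝ)) else 0) := by
    intro v
    unfold lazyStep
    by_cases huv : u = v
    · subst huv; simp
    · simp [huv]
  have hpos : (0 : ℝ) < G.degree u := by exact_mod_cast hd u
  simp_rw [h]
  rw [Finset.sum_add_distrib, Finset.sum_ite_eq, ← Finset.sum_filter, Finset.sum_const,
    ← SimpleGraph.neighborFinset_eq_filter, SimpleGraph.card_neighborFinset_eq_degree]
  simp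
  field_simp
  norm_num

theorem lazyStep_symm (G : SimpleGraph V) [DecidableRel G.Adj] (hd : ∀ v, 1 ≤ G.degree v)
    (u v : V) : (G.degree u : ℝ) * lazyStep G u v = G.degree v * lazyStep G v u := by
  have hu : (0 : ℝ) < G.degree u := by exact_mod_cast hd u
  have hv : (0 : ℝ) < G.degree v := by exact_mod_cast hd v
  unfold lazyStep
  by_cases huv : u = v
  · subst huv; simp
  · have hvu : ¬ v = u := fun h => huv h.symm
    by_cases ha : G.Adj u v
    · simp only [huv, hvu, ha, ha.symm, if_true, if_false]
      field_simp
    · have ha' : ¬ G.Adj v u := fun h => ha h.symm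
      simp [huv, hvu, ha, ha']

theorem lazyStep_adj (G : SimpleGraph V) [DecidableRel G.Adj] (hd : ∀ v, 1 ≤ G.degree v)
    (u v : V) (ha : G.Adj u v) : (G.degree u : ℝ) * lazyStep G u v = 1 / 2 := by
  have hu : (0 : ℝ) < G.degree u := by exact_mod_cast hd u
  unfold lazyStep
  simp only [ha.ne, ha, if_true, if_false]
  field_simp

theorem pow_nonneg' (G : SimpleGraph V) [DecidableRel G.Adj] (k : ℕ) (u v : V) :
    0 ≤ (lazyMat G ^ k) u v := by
  induction k generalizing u with
  | zero => simp only [pow_zero, Matrix.one_apply]; split_ifs <;> norm_num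
  | succ k ih =>
    rw [pow_succ', Matrix.mul_apply]
    exact Finset.sum_nonneg fun z _ => mul_nonneg (lazyStep_nonneg G u z) (ih z)

theorem pow_sum (G : SimpleGraph V) [DecidableRel G.Adj] (hd : ∀ v, 1 ≤ G.degree v)
    (k : ℕ) (u : V) : ∑ v, (lazyMat G ^ k) u v = 1 := by
  induction k generalizing u with
  | zero => simp [Matrix.one_apply]
  | succ k ih =>
    simp_rw [pow_succ', Matrix.mul_apply]
    rw [Finset.sum_comm]
    simp_rw [← Finset.mul_sum, ih, mul_one]
    exact lazyStep_sum G hd u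

theorem pow_symm (G : SimpleGraph V) [DecidableRel G.Adj] (hd : ∀ v, 1 ≤ G.degree v)
    (k : ℕ) (u v : V) :
    (G.degree u : ℝ) * (lazyMat G ^ k) u v = G.degree v * (lazyMat G ^ k) v u := by
  induction k generalizing u v with
  | zero =>
    by_cases h : u = v
    · subst h; rfl
    · have h' : ¬ v = u := fun e => h e.symm
      simp [Matrix.one_apply, h, h']
  | succ k ih =>
    rw [pow_succ', Matrix.mul_apply, ← pow_succ', pow_succ, Matrix.mul_apply,
      Finset.mul_sum, Finset.mul_sum]
    refine Finset.sum_congr rfl fun z _ => ?_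
    have h1 := lazyStep_symm G hd u z
    have h2 := ih z v
    rw [lazyMat_apply, lazyMat_apply, ← mul_assoc, h1]
    linear_combination (lazyStep G z u) * h2

/-- Markov property at the first step. -/
theorem exp_succ (G : SimpleGraph V) [DecidableRel G.Adj] (x : V) (t : ℕ)
    (N : (Fin (t + 2) → V) → ℝ) :
    lazyWalkExp G x (t + 1) N =
      ∑ z, lazyStep G x z * lazyWalkExp G z t (fun f => N (Fin.cons x f)) := by
  unfold lazyWalkExp
  rw [← (Fin.consEquiv (fun _ : Fin (t + 2) => V)).sum_comp, Fintype.sum_prod_type]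
  rw [Finset.sum_eq_single x]
  · simp_rw [Finset.mul_sum]
    rw [Finset.sum_comm]
    refine Finset.sum_congr rfl fun f _ => ?_
    rw [Finset.sum_eq_single (f 0)]
    · simp [lazyWalkLaw, Fin.consEquiv, Fin.prod_univ_succ]
      ring
    · intro z _ hz
      simp [lazyWalkLaw, hz.symm]
    · simp
  · intro z _ hz
    simp [lazyWalkLaw, Fin.consEquiv, hz]
  · simp

theorem exp_one (G : SimpleGraph V) [DecidableRel G.Adj] (hd : ∀ v, 1 ≤ G.degree v)
    (x : V) (t : ℕ) : lazyWalkExp G x t (fun _ => 1) = 1 := by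
  induction t generalizing x with
  | zero =>
    unfold lazyWalkExp lazyWalkLaw
    rw [← (Equiv.funUnique (Fin 1) V).symm.sum_comp]
    simp
  | succ t ih =>
    rw [exp_succ]
    simp_rw [ih, mul_one]
    exact lazyStep_sum G hd x

theorem exp_head (G : SimpleGraph V) [DecidableRel G.Adj] (x y : V) (t : ℕ)
    (N : (Fin (t + 1) → V) → ℝ) :
    lazyWalkExp G x t (fun f => if f 0 = y then N f else 0) =
      if x = y then lazyWalkExp G x t N else 0 := by
  unfold lazyWalkExp lazyWalkLaw
  by_cases h : x = y
  · subst h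
    simp only [if_true]
    refine Finset.sum_congr rfl fun f _ => ?_
    by_cases hf : f 0 = x <;> simp [hf]
  · rw [if_neg h]
    refine Finset.sum_eq_zero fun f _ => ?_
    by_cases hf : f 0 = x
    · simp [hf, h]
    · simp [hf]

theorem exp_visit (G : SimpleGraph V) [DecidableRel G.Adj] (hd : ∀ v, 1 ≤ G.degree v)
    (x y : V) (t : ℕ) (i : Fin (t + 1)) :
    lazyWalkExp G x t (fun f => if f i = y then 1 else 0) = (lazyMat G ^ (i : ℕ)) x y := by
  induction t generalizing x with
  | zero =>
    have : i = 0 := Fin.fin_one_eq_zero i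
    subst this
    rw [exp_head, exp_one G hd]
    simp [Matrix.one_apply]
  | succ t ih =>
    refine Fin.cases ?_ (fun i => ?_) i
    · rw [exp_head, exp_one G hd]
      simp [Matrix.one_apply]
    · rw [exp_succ, Fin.val_succ, pow_succ', Matrix.mul_apply]
      simp_rw [Fin.cons_succ, ih]
      rfl

theorem exp_pair (G : SimpleGraph V) [DecidableRel G.Adj] (hd : ∀ v, 1 ≤ G.degree v)
    (x y : V) (t : ℕ) (i j : Fin (t + 1)) (hij : i ≤ j) :
    lazyWalkExp G x t (fun f => if f i = y then (if f j = y then 1 else 0) else 0) =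
      (lazyMat G ^ (i : ℕ)) x y * (lazyMat G ^ ((j : ℕ) - i)) y y := by
  have base : ∀ (t : ℕ) (x : V) (j : Fin (t + 1)),
      lazyWalkExp G x t (fun f => if f 0 = y then (if f j = y then 1 else 0) else 0) =
      (lazyMat G ^ ((0 : Fin (t + 1)) : ℕ)) x y *
        (lazyMat G ^ ((j : ℕ) - (0 : Fin (t + 1)))) y y := by
    intro t x j
    rw [exp_head, exp_visit G hd]
    by_cases h : x = y
    · subst h; simp
    · simp [h]
  induction t generalizing x with
  | zero =>
    have : i = 0 := Fin.fin_one_eq_zero i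
    subst this
    exact base 0 x j
  | succ t ih =>
    induction i using Fin.cases with
    | zero => exact base _ x j
    | succ i =>
      induction j using Fin.cases with
      | zero => simp at hij
      | succ j =>
        have hij' : i ≤ j := by simpa using hij
        rw [exp_succ]
        simp_rw [Fin.cons_succ, ih _ i j hij']
        rw [Fin.val_succ, Fin.val_succ, pow_succ', Matrix.mul_apply, Finset.sum_mul,
          Nat.add_sub_add_right]
        refine Finset.sum_congr rfl fun z _ => ?_
        rw [lazyMat_apply, mul_assoc]

theorem pr_pair (G : SimpleGraph V) [DecidableRel G.Adj] (hd : ∀ v, 1 ≤ G.degree v)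
    (x y : V) (t : ℕ) (i j : Fin (t + 1)) (hij : i ≤ j) :
    lazyWalkPr G x t {f | f i = y ∧ f j = y} =
      (lazyMat G ^ (i : ℕ)) x y * (lazyMat G ^ ((j : ℕ) - i)) y y := by
  rw [← exp_pair G hd x y t i j hij]
  unfold lazyWalkPr lazyWalkExp
  refine Finset.sum_congr rfl fun f _ => ?_
  by_cases h1 : f i = y <;> by_cases h2 : f j = y <;> simp [Set.indicator, h1, h2]

/-- Expected number of visits to `y` up to time `t` from `v`. -/
noncomputable def green (G : SimpleGraph V) [DecidableRel G.Adj] (y : V) (t : ℕ) (v : V) : ℝ :=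
  ∑ k ∈ Finset.range (t + 1), (lazyMat G ^ k) v y

theorem green_nonneg (G : SimpleGraph V) [DecidableRel G.Adj] (y : V) (t : ℕ) (v : V) :
    0 ≤ green G y t v := Finset.sum_nonneg fun k _ => pow_nonneg' G k v y

theorem pairs_le (G : SimpleGraph V) [DecidableRel G.Adj] (hd : ∀ v, 1 ≤ G.degree v)
    (x y : V) (t : ℕ) :
    ∑ p ∈ Finset.univ.filter (fun p : Fin (t + 1) × Fin (t + 1) => p.1 < p.2),
      lazyWalkPr G x t {f | f p.1 = y ∧ f p.2 = y} ≤ green G y t x * green G y t y := by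
  have h1 : ∑ p ∈ Finset.univ.filter (fun p : Fin (t + 1) × Fin (t + 1) => p.1 < p.2),
      lazyWalkPr G x t {f | f p.1 = y ∧ f p.2 = y} =
      ∑ p ∈ Finset.univ.filter (fun p : Fin (t + 1) × Fin (t + 1) => p.1 < p.2),
        (fun q : ℕ × ℕ => (lazyMat G ^ q.1) x y * (lazyMat G ^ q.2) y y)
          ((p.1 : ℕ), (p.2 : ℕ) - p.1) := by
    refine Finset.sum_congr rfl fun p hp => ?_
    exact pr_pair G hd x y t p.1 p.2 (Finset.mem_filter.1 hp).2.le
  rw [h1, ← Finset.sum_image (f := fun q : ℕ × ℕ =>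
    (lazyMat G ^ q.1) x y * (lazyMat G ^ q.2) y y)]
  · unfold green
    rw [Finset.sum_mul_sum, ← Finset.sum_product']
    refine Finset.sum_le_sum_of_subset_of_nonneg ?_ ?_
    · intro q hq
      obtain ⟨p, hp, rfl⟩ := Finset.mem_image.1 hq
      have := p.1.2
      have := p.2.2
      simp only [Finset.mem_product, Finset.mem_range]
      omega
    · intro q _ _
      exact mul_nonneg (pow_nonneg' G _ _ _) (pow_nonneg' G _ _ _)
  · intro p hp q hq h
    have hp' : p.1 < p.2 := by simpa using hp
    have hq' : q.1 < q.2 := by simpa using hq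
    simp only [Prod.mk.injEq] at h
    rw [Fin.lt_def] at hp' hq'
    apply Prod.ext <;> apply Fin.ext <;> omega

theorem green_mass (G : SimpleGraph V) [DecidableRel G.Adj] (hd : ∀ v, 1 ≤ G.degree v)
    (y : V) (t : ℕ) : ∑ v, (G.degree v : ℝ) * green G y t v = G.degree y * (t + 1) := by
  unfold green
  simp_rw [Finset.mul_sum]
  rw [Finset.sum_comm]
  simp_rw [fun k v => pow_symm G hd k v y, ← Finset.mul_sum, pow_sum G hd]
  simp

theorem green_eq (G : SimpleGraph V) [DecidableRel G.Adj] (y : V) (t : ℕ) (v : V) :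
    green G y t v - ∑ u, lazyStep G v u * green G y t u =
      (if v = y then 1 else 0) - (lazyMat G ^ (t + 1)) v y := by
  have h : ∑ u, lazyStep G v u * green G y t u =
      ∑ k ∈ Finset.range (t + 1), (lazyMat G ^ (k + 1)) v y := by
    unfold green
    simp_rw [Finset.mul_sum]
    rw [Finset.sum_comm]
    refine Finset.sum_congr rfl fun k _ => ?_
    rw [pow_succ', Matrix.mul_apply]
    rfl
  have h2 := Finset.sum_range_succ (fun k => (lazyMat G ^ k) v y) (t + 1)
  have h3 := Finset.sum_range_succ' (fun k => (lazyMat G ^ k) v y) (t + 1)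
  simp only [pow_zero, Matrix.one_apply] at h3
  rw [h]
  unfold green
  linarith

theorem energy_eq (G : SimpleGraph V) [DecidableRel G.Adj] (hd : ∀ v, 1 ≤ G.degree v)
    (g : V → ℝ) :
    ∑ v, ∑ u, (G.degree v : ℝ) * lazyStep G v u * (g v - g u) ^ 2 =
      2 * ∑ v, (G.degree v : ℝ) * g v * (g v - ∑ u, lazyStep G v u * g u) := by
  have hA : ∑ v, ∑ u, (G.degree v : ℝ) * lazyStep G v u * g v ^ 2 =
      ∑ v, (G.degree v : ℝ) * g v ^ 2 := by
    refine Finset.sum_congr rfl fun v _ => ?_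
    rw [← Finset.sum_mul, ← Finset.mul_sum, lazyStep_sum G hd, mul_one]
  have hB : ∑ v, ∑ u, (G.degree v : ℝ) * lazyStep G v u * g u ^ 2 =
      ∑ v, (G.degree v : ℝ) * g v ^ 2 := by
    rw [Finset.sum_comm, ← hA]
    refine Finset.sum_congr rfl fun v _ => Finset.sum_congr rfl fun u _ => ?_
    rw [lazyStep_symm G hd u v]
  have hC : ∑ v, ∑ u, (G.degree v : ℝ) * lazyStep G v u * (g v - g u) ^ 2 =
      ∑ v, ∑ u, (G.degree v : ℝ) * lazyStep G v u * g v ^ 2 +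
      ∑ v, ∑ u, (G.degree v : ℝ) * lazyStep G v u * g u ^ 2 -
      2 * ∑ v, ∑ u, (G.degree v : ℝ) * g v * (lazyStep G v u * g u) := by
    simp_rw [Finset.mul_sum, ← Finset.sum_add_distrib, ← Finset.sum_sub_distrib]
    refine Finset.sum_congr rfl fun v _ => Finset.sum_congr rfl fun u _ => ?_
    ring
  rw [hC, hA, hB]
  simp_rw [mul_sub, Finset.sum_sub_distrib, Finset.mul_sum, ← Finset.sum_add_distrib]
  have : ∀ v, (G.degree v : ℝ) * g v * g v = G.degree v * g v ^ 2 := fun v => by ring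
  simp_rw [this]
  rw [mul_sub, Finset.sum_add_distrib, two_mul]
  simp_rw [Finset.mul_sum]

theorem green_energy (G : SimpleGraph V) [DecidableRel G.Adj] (hd : ∀ v, 1 ≤ G.degree v)
    (y : V) (t : ℕ) :
    ∑ v, ∑ u, (if G.Adj v u then (green G y t v - green G y t u) ^ 2 else 0) ≤
      4 * (G.degree y * green G y t y) := by
  have h1 := energy_eq G hd (green G y t)
  simp_rw [green_eq] at h1
  have h2 : ∑ v, (G.degree v : ℝ) * green G y t v *
      ((if v = y then 1 else 0) - (lazyMat G ^ (t + 1)) v y) ≤ G.degree y * green G y t y := by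
    have : ∑ v, (G.degree v : ℝ) * green G y t v * (if v = y then (1 : ℝ) else 0) =
      G.degree y * green G y t y := by simp
    rw [← this]
    refine Finset.sum_le_sum fun v _ => ?_
    have h3 := pow_nonneg' G (t + 1) v y
    have h4 := green_nonneg G y t v
    refine mul_le_mul_of_nonneg_left (by linarith) (by positivity)
  have h5 : (1 / 2 : ℝ) *
      ∑ v, ∑ u, (if G.Adj v u then (green G y t v - green G y t u) ^ 2 else 0) ≤
      ∑ v, ∑ u, (G.degree v : ℝ) * lazyStep G v u * (green G y t v - green G y t u) ^ 2 := by
    rw [Finset.mul_sum]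
    refine Finset.sum_le_sum fun v _ => ?_
    rw [Finset.mul_sum]
    refine Finset.sum_le_sum fun u _ => ?_
    by_cases ha : G.Adj v u
    · rw [if_pos ha, lazyStep_adj G hd v u ha]
    · rw [if_neg ha, mul_zero]
      have := lazyStep_nonneg G v u
      positivity
  linarith

theorem green_le (G : SimpleGraph V) [DecidableRel G.Adj] (hc : G.Connected)
    (hd : ∀ v, 1 ≤ G.degree v) (y : V) (t : ℕ)
    (ht : (t : ℝ) ≤ (G.edgeFinset.card : ℝ) ^ 2) :
    ∃ M : ℝ, (∀ v, green G y t v ≤ M) ∧ M ^ 2 ≤ 64 * (G.degree y : ℝ) ^ 2 * (t + 1) := by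
  have : Nonempty V := ⟨y⟩
  obtain ⟨a, -, ha⟩ := Finset.exists_max_image (Finset.univ : Finset V) (green G y t)
    Finset.univ_nonempty
  refine ⟨green G y t a, fun v => ha v (Finset.mem_univ v), ?_⟩
  have hE := green_energy G hd y t
  have hS := green_mass G hd y t
  have hN := green_nonneg G y t
  have hya := ha y (Finset.mem_univ y)
  have hdy : (1 : ℝ) ≤ G.degree y := by exact_mod_cast hd y
  have ht0 : (0 : ℝ) ≤ t := Nat.cast_nonneg t
  set g := green G y t with hg
  set M := g a with hM
  set d : ℝ := (G.degree y : ℝ) with hdd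
  rcases (hN a).eq_or_lt with h0 | hMpos
  · rw [← hM] at h0
    rw [← h0, zero_pow two_ne_zero]; positivity
  by_cases hall : ∀ v, M / 2 < g v
  · have hm : (G.degree y) ≤ 2 * G.edgeFinset.card := by
      rw [← G.sum_degrees_eq_twice_card_edges]
      exact Finset.single_le_sum (f := fun v => G.degree v) (fun _ _ => Nat.zero_le _)
        (Finset.mem_univ y)
    have hm1 : 1 ≤ G.edgeFinset.card := by have := hd y; omega
    have hm1' : (1 : ℝ) ≤ G.edgeFinset.card := by exact_mod_cast hm1
    have hsum : (∑ v, (G.degree v : ℝ)) = 2 * G.edgeFinset.card := by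
      exact_mod_cast G.sum_degrees_eq_twice_card_edges
    have h1 : (∑ v, (G.degree v : ℝ)) * (M / 2) ≤ d * (t + 1) := by
      rw [← hS, Finset.sum_mul]
      exact Finset.sum_le_sum fun v _ =>
        mul_le_mul_of_nonneg_left (hall v).le (Nat.cast_nonneg _)
    rw [hsum] at h1
    set m : ℝ := (G.edgeFinset.card : ℝ) with hmm
    have h2 : m * M ≤ d * (t + 1) := by linarith
    have h3 : (m * M) ^ 2 ≤ (d * (t + 1)) ^ 2 := by gcongr
    have h4 : (t : ℝ) + 1 ≤ 2 * m ^ 2 := by nlinarith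
    have h5 : m ^ 2 * M ^ 2 ≤ m ^ 2 * (2 * (d ^ 2 * (t + 1))) := by
      calc m ^ 2 * M ^ 2 = (m * M) ^ 2 := by ring
        _ ≤ (d ^ 2 * (t + 1)) * (t + 1) := by linarith
        _ ≤ (d ^ 2 * (t + 1)) * (2 * m ^ 2) := by gcongr
        _ = _ := by ring
    have h6 := le_of_mul_le_mul_left h5 (by positivity)
    have : 0 ≤ d ^ 2 * ((t : ℝ) + 1) := by positivity
    nlinarith
  · push Not at hall
    obtain ⟨b, hb⟩ := hall
    obtain ⟨p, hp⟩ := hc.exists_isPath a b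
    have hex : ∃ r, g (p.getVert r) ≤ M / 2 := ⟨p.length, by simpa using hb⟩
    set r := Nat.find hex with hr
    have hr1 : g (p.getVert r) ≤ M / 2 := Nat.find_spec hex
    have hrl : r ≤ p.length := Nat.find_min' hex (by simpa using hb)
    have hr2 : ∀ i < r, M / 2 < g (p.getVert i) := fun i hi => by
      have := Nat.find_min hex hi
      exact not_le.1 this
    have hinj : Set.InjOn p.getVert (Finset.range r : Set ℕ) := by
      intro i hi j hj hij
      simp only [Finset.coe_range, Set.mem_Iio] at hi hj
      exact hp.getVert_injOn (by simp; omega) (by simp; omega) hij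
    -- mass bound
    have hmass : (r : ℝ) * (M / 2) ≤ d * (t + 1) := by
      calc (r : ℝ) * (M / 2) = ∑ i ∈ Finset.range r, M / 2 := by simp
        _ ≤ ∑ i ∈ Finset.range r, g (p.getVert i) :=
          Finset.sum_le_sum fun i hi => (hr2 i (Finset.mem_range.1 hi)).le
        _ = ∑ v ∈ (Finset.range r).image p.getVert, g v := (Finset.sum_image hinj).symm
        _ ≤ ∑ v, g v := Finset.sum_le_sum_of_subset_of_nonneg (Finset.subset_univ _)
          fun v _ _ => hN v
        _ ≤ ∑ v, (G.degree v : ℝ) * g v := Finset.sum_le_sum fun v _ =>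
          le_mul_of_one_le_left (hN v) (by exact_mod_cast hd v)
        _ = _ := hS
    -- energy bound
    have hen : ∑ i ∈ Finset.range r, (g (p.getVert i) - g (p.getVert (i + 1))) ^ 2 ≤
        4 * (d * M) := by
      calc ∑ i ∈ Finset.range r, (g (p.getVert i) - g (p.getVert (i + 1))) ^ 2
          ≤ ∑ i ∈ Finset.range r, ∑ u,
            (if G.Adj (p.getVert i) u then (g (p.getVert i) - g u) ^ 2 else 0) := by
            refine Finset.sum_le_sum fun i hi => ?_
            have hadj := p.adj_getVert_succ (i := i) (by
              have := Finset.mem_range.1 hi; omega)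
            have := Finset.single_le_sum (s := Finset.univ) (f := fun u =>
              (if G.Adj (p.getVert i) u then (g (p.getVert i) - g u) ^ 2 else 0))
              (fun u _ => by split_ifs <;> positivity)
              (Finset.mem_univ (p.getVert (i + 1)))
            simpa only [if_pos hadj] using this
        _ = ∑ v ∈ (Finset.range r).image p.getVert, ∑ u,
            (if G.Adj v u then (g v - g u) ^ 2 else 0) :=
          (Finset.sum_image (f := fun v => ∑ u,
            (if G.Adj v u then (g v - g u) ^ 2 else 0)) hinj).symm
        _ ≤ ∑ v, ∑ u, (if G.Adj v u then (g v - g u) ^ 2 else 0) :=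
          Finset.sum_le_sum_of_subset_of_nonneg (Finset.subset_univ _)
            fun v _ _ => Finset.sum_nonneg fun u _ => by split_ifs <;> positivity
        _ ≤ 4 * (d * g y) := hE
        _ ≤ 4 * (d * M) := by gcongr
    have htel : ∑ i ∈ Finset.range r, (g (p.getVert i) - g (p.getVert (i + 1))) =
        M - g (p.getVert r) := by
      rw [Finset.sum_range_sub' (fun i => g (p.getVert i))]
      simp [hM]
    have hcs := sq_sum_le_card_mul_sum_sq (s := Finset.range r)
      (f := fun i => g (p.getVert i) - g (p.getVert (i + 1)))
    rw [htel, Finset.card_range] at hcs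
    have h1 : (M / 2) ^ 2 ≤ (M - g (p.getVert r)) ^ 2 := by
      have : M / 2 ≤ M - g (p.getVert r) := by linarith
      gcongr
    have h2 : (M / 2) ^ 2 ≤ r * (4 * (d * M)) :=
      h1.trans (hcs.trans (mul_le_mul_of_nonneg_left hen (Nat.cast_nonneg r)))
    have h3 : d * ((r : ℝ) * (M / 2)) ≤ d * (d * (t + 1)) :=
      mul_le_mul_of_nonneg_left hmass (by linarith)
    have : 0 ≤ d ^ 2 * ((t : ℝ) + 1) := by positivity
    nlinarith

end Aux

/-- `∑_{0 ≤ i < j ≤ t} Pr(X_i = y ∧ X_j = y) ≤ 64·d(y)²·(t+1)`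
for all `t ≤ β·m²`. -/
theorem statement_2 :
    ∃ β : ℝ, 0 < β ∧
      ∀ (V : Type) [Fintype V] [DecidableEq V] (G : SimpleGraph V) [DecidableRel G.Adj],
        G.Connected → (∀ v : V, 1 ≤ G.degree v) →
        ∀ x y : V, ∀ t : ℕ,
          (t : ℝ) ≤ β * (G.edgeFinset.card : ℝ) ^ 2 →
          ∑ p ∈ Finset.univ.filter (fun p : Fin (t + 1) × Fin (t + 1) => p.1 < p.2),
              lazyWalkPr G x t {f | f p.1 = y ∧ f p.2 = y} ≤
            64 * (G.degree y : ℝ) ^ 2 * (t + 1) := by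
  refine ⟨1, one_pos, ?_⟩
  intro V _ _ G _ hc hd x y t ht
  obtain ⟨M, hM, hM2⟩ := green_le G hc hd y t (by simpa using ht)
  refine (pairs_le G hd x y t).trans (le_trans ?_ hM2)
  rw [sq]
  exact mul_le_mul (hM x) (hM y) (green_nonneg G y t y) ((green_nonneg G y t x).trans (hM x))
end

section
/- There exists a constant β > 0 such that the following holds. For every finite simple connected undirected graph G with m edges in which every vertex has degree at least 1, for every pair of vertices x, y and every natural number t with t ≤ β·m², the number of visits to y by the lazy simple random walk of length t started at x satisfies Pr(N_t^x(y) ≥ 24·d(y)·√(t+1)) ≤ 1/4. -/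
open Finset

section Aux

variable {V : Type} [Fintype V] [DecidableEq V] (G : SimpleGraph V) [DecidableRel G.Adj]

lemma aux_step_nonneg (u v : V) : 0 ≤ lazyStep G u v := by
  unfold lazyStep
  split_ifs <;> positivity

lemma aux_step_sum (hd : ∀ v : V, 1 ≤ G.degree v) (φ : V → ℝ) (u : V) :
    (G.degree u : ℝ) * ∑ v, lazyStep G u v * φ v =
      (G.degree u : ℝ) / 2 * φ u + 1 / 2 * ∑ v, (if G.Adj u v then φ v else 0) := by
  have h0 : (G.degree u : ℝ) ≠ 0 := by
    have := hd u
    positivity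
  have h : ∀ v, (G.degree u : ℝ) * (lazyStep G u v * φ v) =
      (if u = v then (G.degree u : ℝ) / 2 * φ v else 0) +
        1 / 2 * (if G.Adj u v then φ v else 0) := by
    intro v
    unfold lazyStep
    by_cases huv : u = v
    · subst huv
      simp
      ring
    · simp only [huv, if_false]
      split_ifs
      · field_simp
        ring
      · simp
  rw [Finset.mul_sum, Finset.sum_congr rfl (fun v _ => h v), Finset.sum_add_distrib,
    ← Finset.mul_sum]
  simp

lemma aux_deg (u : V) (c : ℝ) :
    ∑ v, (if G.Adj u v then c else 0) = (G.degree u : ℝ) * c := by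
  rw [← Finset.sum_filter, Finset.sum_const, nsmul_eq_mul, ← G.card_neighborFinset_eq_degree,
    G.neighborFinset_eq_filter]

lemma aux_step_one (hd : ∀ v : V, 1 ≤ G.degree v) (u : V) : ∑ v, lazyStep G u v = 1 := by
  have h0 : (G.degree u : ℝ) ≠ 0 := by
    have := hd u
    positivity
  have h := aux_step_sum G hd (fun _ => 1) u
  rw [aux_deg] at h
  simp only [mul_one] at h
  apply mul_left_cancel₀ h0
  linarith

lemma aux_exp_succ (x : V) (t : ℕ) (F : (Fin (t + 2) → V) → ℝ) :
    lazyWalkExp G x (t + 1) F =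
      ∑ v, lazyStep G x v * lazyWalkExp G v t (fun f => F (Fin.cons x f)) := by
  unfold lazyWalkExp
  rw [← (Fin.consEquiv (fun _ : Fin (t + 2) => V)).sum_comp, Fintype.sum_prod_type]
  simp only [Finset.mul_sum]
  rw [Finset.sum_comm, Finset.sum_comm (γ := V)]
  apply Finset.sum_congr rfl
  intro f _
  unfold lazyWalkLaw
  rw [Finset.sum_eq_single x, Finset.sum_eq_single (f 0)]
  · simp [Fin.consEquiv, Fin.prod_univ_succ]
    ring
  · intro b _ hb
    simp [hb.symm]
  · simp
  · intro b _ hb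
    simp [Fin.consEquiv, hb]
  · simp

lemma aux_exp_one (hd : ∀ v : V, 1 ≤ G.degree v) (t : ℕ) :
    ∀ x : V, lazyWalkExp G x t (fun _ => 1) = 1 := by
  induction t with
  | zero =>
    intro x
    unfold lazyWalkExp lazyWalkLaw
    rw [← (Fin.consEquiv (fun _ : Fin 1 => V)).sum_comp, Fintype.sum_prod_type]
    simp [Fin.consEquiv]
  | succ t ih =>
    intro x
    rw [aux_exp_succ]
    simp [ih, aux_step_one G hd]

lemma aux_visits_cons (y x : V) (t : ℕ) (f : Fin (t + 1) → V) :
    (visits y (t := t + 1) (Fin.cons x f) : ℝ) = (if x = y then 1 else 0) + (visits y f : ℝ) := by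
  unfold visits
  simp only [Finset.card_filter]
  rw [Fin.sum_univ_succ]
  simp

/-- Expected number of visits, by recursion on the length of the walk. -/
noncomputable def auxA (y : V) : ℕ → V → ℝ
  | 0, x => if x = y then 1 else 0
  | t + 1, x => (if x = y then 1 else 0) + ∑ v, lazyStep G x v * auxA y t v

lemma aux_exp_visits (hd : ∀ v : V, 1 ≤ G.degree v) (y : V) (t : ℕ) :
    ∀ x : V, lazyWalkExp G x t (fun f => (visits y f : ℝ)) = auxA G y t x := by
  induction t with
  | zero =>
    intro x
    unfold lazyWalkExp lazyWalkLaw auxA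
    rw [← (Fin.consEquiv (fun _ : Fin 1 => V)).sum_comp, Fintype.sum_prod_type]
    simp only [visits, Finset.card_filter, Finset.univ_unique, Finset.sum_singleton]
    simp [Fin.consEquiv]
    simp only [eq_comm]
  | succ t ih =>
    intro x
    rw [aux_exp_succ, auxA]
    have h : ∀ v, lazyWalkExp G v t (fun f => (visits y (t := t + 1) (Fin.cons x f) : ℝ)) =
        (if x = y then 1 else 0) + auxA G y t v := by
      intro v
      rw [← ih v]
      have h1 := aux_exp_one G hd t v
      unfold lazyWalkExp at h1 ⊢
      simp only [mul_one] at h1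
      simp only [aux_visits_cons, mul_add, Finset.sum_add_distrib]
      rw [← Finset.sum_mul, h1, one_mul]
    simp only [h, mul_add, Finset.sum_add_distrib]
    rw [← Finset.sum_mul, aux_step_one G hd, one_mul]

lemma aux_law_nonneg (x : V) (t : ℕ) (f : Fin (t + 1) → V) : 0 ≤ lazyWalkLaw G x t f := by
  unfold lazyWalkLaw
  apply mul_nonneg
  · split_ifs <;> norm_num
  · exact Finset.prod_nonneg fun i _ => aux_step_nonneg G _ _

lemma aux_markov (x : V) (t : ℕ) (F : (Fin (t + 1) → V) → ℝ) (hF : ∀ f, 0 ≤ F f) (a : ℝ) :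
    a * lazyWalkPr G x t {f | a ≤ F f} ≤ lazyWalkExp G x t F := by
  unfold lazyWalkPr lazyWalkExp
  rw [Finset.mul_sum]
  apply Finset.sum_le_sum
  intro f _
  have h := aux_law_nonneg G x t f
  by_cases hf : a ≤ F f
  · rw [Set.indicator_of_mem (by exact hf), mul_comm]
    exact mul_le_mul_of_nonneg_left hf h
  · rw [Set.indicator_of_notMem (by exact hf), mul_zero]
    exact mul_nonneg h (hF f)

lemma auxA_nonneg (y : V) (t : ℕ) : ∀ x, 0 ≤ auxA G y t x := by
  induction t with
  | zero =>
    intro x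
    unfold auxA
    split_ifs <;> norm_num
  | succ t ih =>
    intro x
    unfold auxA
    apply add_nonneg
    · split_ifs <;> norm_num
    · exact Finset.sum_nonneg fun v _ => mul_nonneg (aux_step_nonneg G _ _) (ih v)

lemma auxA_mono (y : V) (t : ℕ) : ∀ x, auxA G y t x ≤ auxA G y (t + 1) x := by
  induction t with
  | zero =>
    intro x
    rw [auxA, auxA]
    have : 0 ≤ ∑ v, lazyStep G x v * auxA G y 0 v :=
      Finset.sum_nonneg fun v _ => mul_nonneg (aux_step_nonneg G _ _) (auxA_nonneg G y 0 v)
    linarith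
  | succ t ih =>
    intro x
    rw [auxA, auxA]
    gcongr with v
    · exact aux_step_nonneg G _ _
    · exact ih v

lemma aux_swap (φ : V → ℝ) :
    ∑ u, ∑ v, (if G.Adj u v then φ v else 0) = ∑ v, (G.degree v : ℝ) * φ v := by
  rw [Finset.sum_comm]
  apply Finset.sum_congr rfl
  intro v _
  rw [← aux_deg]
  simp only [G.adj_comm]

lemma auxA_sum (hd : ∀ v : V, 1 ≤ G.degree v) (y : V) (t : ℕ) :
    ∑ v, (G.degree v : ℝ) * auxA G y t v = (t + 1) * (G.degree y : ℝ) := by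
  induction t with
  | zero =>
    simp [auxA]
  | succ t ih =>
    simp only [auxA, mul_add, aux_step_sum G hd, Finset.sum_add_distrib]
    rw [← Finset.mul_sum, aux_swap, ih]
    have : ∑ v, (G.degree v : ℝ) / 2 * auxA G y t v = 1 / 2 * ((t + 1) * (G.degree y : ℝ)) := by
      rw [← ih, Finset.mul_sum]
      exact Finset.sum_congr rfl fun v _ => by ring
    rw [this]
    push_cast
    simp
    ring

lemma aux_energy (hd : ∀ v : V, 1 ≤ G.degree v) (φ : V → ℝ) :
    ∑ u, ∑ v, (if G.Adj u v then (φ u - φ v) ^ 2 else 0) =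
      4 * ∑ u, (G.degree u : ℝ) * φ u * (φ u - ∑ v, lazyStep G u v * φ v) := by
  have h1 : ∀ u, (G.degree u : ℝ) * φ u * (φ u - ∑ v, lazyStep G u v * φ v) =
      1 / 2 * ((G.degree u : ℝ) * φ u ^ 2) -
        1 / 2 * ∑ v, (if G.Adj u v then φ u * φ v else 0) := by
    intro u
    have h := aux_step_sum G hd φ u
    have h2 : ∑ v, (if G.Adj u v then φ u * φ v else 0) =
        φ u * ∑ v, (if G.Adj u v then φ v else 0) := by
      rw [Finset.mul_sum]
      exact Finset.sum_congr rfl fun v _ => by split_ifs <;> simp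
    rw [h2]
    linear_combination (-φ u) * h
  have h3 : ∀ u v, (if G.Adj u v then (φ u - φ v) ^ 2 else 0) =
      (if G.Adj u v then (φ u) ^ 2 else 0) + (if G.Adj u v then (φ v) ^ 2 else 0)
        - 2 * (if G.Adj u v then φ u * φ v else 0) := by
    intro u v
    split_ifs <;> ring
  simp only [h1, h3, Finset.sum_add_distrib, Finset.sum_sub_distrib, aux_deg, ← Finset.mul_sum]
  rw [aux_swap G (fun v => φ v ^ 2)]
  ring

lemma auxA_energy (hd : ∀ v : V, 1 ≤ G.degree v) (y : V) (t : ℕ) :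
    ∑ u, ∑ v, (if G.Adj u v then (auxA G y t u - auxA G y t v) ^ 2 else 0) ≤
      4 * ((G.degree y : ℝ) * auxA G y t y) := by
  rw [aux_energy G hd]
  gcongr
  calc _ ≤ ∑ u, (G.degree u : ℝ) * auxA G y t u * (if u = y then 1 else 0) := by
        apply Finset.sum_le_sum
        intro u _
        apply mul_le_mul_of_nonneg_left
        · have := auxA_mono G y t u
          rw [show auxA G y (t + 1) u = (if u = y then 1 else 0) +
            ∑ v, lazyStep G u v * auxA G y t v from rfl] at this
          linarith
        · exact mul_nonneg (by positivity) (auxA_nonneg G y t u)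
    _ = _ := by simp

lemma aux_drop (w : ℕ → V) (φ : V → ℝ) (r : ℕ) (hinj : Set.InjOn w (Set.Iio r))
    (hadj : ∀ i < r, G.Adj (w i) (w (i + 1))) :
    (φ (w 0) - φ (w r)) ^ 2 ≤
      r * ∑ u, ∑ v, (if G.Adj u v then (φ u - φ v) ^ 2 else 0) := by
  have h1 : φ (w 0) - φ (w r) = ∑ i ∈ Finset.range r, (φ (w i) - φ (w (i + 1))) :=
    (Finset.sum_range_sub' (fun i => φ (w i)) r).symm
  rw [h1]
  refine (sq_sum_le_card_mul_sum_sq).trans ?_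
  rw [Finset.card_range]
  gcongr
  calc _ ≤ ∑ i ∈ Finset.range r, ∑ v, (if G.Adj (w i) v then (φ (w i) - φ v) ^ 2 else 0) := by
        apply Finset.sum_le_sum
        intro i hi
        have := Finset.single_le_sum
          (f := fun v => if G.Adj (w i) v then (φ (w i) - φ v) ^ 2 else 0) (s := Finset.univ)
          (fun v _ => by split_ifs <;> positivity) (Finset.mem_univ (w (i + 1)))
        simpa [hadj i (Finset.mem_range.1 hi)] using this
    _ = ∑ u ∈ (Finset.range r).image w, ∑ v, (if G.Adj u v then (φ u - φ v) ^ 2 else 0) := by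
        rw [Finset.sum_image]
        intro a ha b hb
        exact hinj (by simpa using ha) (by simpa using hb)
    _ ≤ _ := by
        apply Finset.sum_le_sum_of_subset_of_nonneg (Finset.subset_univ _)
        intro u _ _
        exact Finset.sum_nonneg fun v _ => by split_ifs <;> positivity

lemma aux_walk (hG : G.Connected) (S : V → Prop) (a : V) (hb : ∃ b, S b) :
    ∃ (w : ℕ → V) (r : ℕ), w 0 = a ∧ S (w r) ∧ (∀ i < r, ¬ S (w i)) ∧
      Set.InjOn w (Set.Iio r) ∧ ∀ i < r, G.Adj (w i) (w (i + 1)) := by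
  classical
  obtain ⟨b, hb⟩ := hb
  obtain ⟨p, hp⟩ := hG.exists_isPath a b
  have hex : ∃ r, S (p.getVert r) := ⟨p.length, by simpa using hb⟩
  have hle : Nat.find hex ≤ p.length := Nat.find_le (by simpa using hb)
  refine ⟨p.getVert, Nat.find hex, by simp, Nat.find_spec hex, fun i hi => Nat.find_min hex hi,
    ?_, ?_⟩
  · intro i hi j hj hij
    have hi' : i < Nat.find hex := hi
    have hj' : j < Nat.find hex := hj
    exact hp.getVert_injOn (show i ≤ p.length by omega) (show j ≤ p.length by omega) hij
  · intro i hi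
    exact p.adj_getVert_succ (by omega)

lemma aux_bound (hG : G.Connected) (hd : ∀ v : V, 1 ≤ G.degree v) (y : V) (t : ℕ)
    (ht : (t : ℝ) ≤ (G.edgeFinset.card : ℝ) ^ 2) (x : V) :
    (auxA G y t x) ^ 2 ≤ 36 * (G.degree y : ℝ) ^ 2 * (t + 1) := by
  have : Nonempty V := ⟨x⟩
  obtain ⟨z, hz⟩ := Finite.exists_max (auxA G y t)
  set A := auxA G y t with hA
  have hA0 : ∀ v, 0 ≤ A v := auxA_nonneg G y t
  set D : ℝ := (G.degree y : ℝ) with hD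
  have hD0 : 0 ≤ D := by positivity
  have hdeg : ∀ v, (1 : ℝ) ≤ (G.degree v : ℝ) := fun v => by exact_mod_cast hd v
  have hsum : ∑ v, (G.degree v : ℝ) * A v = (t + 1) * D := auxA_sum G hd y t
  suffices h : (A z) ^ 2 ≤ 36 * D ^ 2 * (t + 1) from
    (pow_le_pow_left₀ (hA0 x) (hz x) 2).trans h
  rcases (hA0 z).eq_or_lt with h0 | hpos
  · rw [← h0, zero_pow two_ne_zero]
    positivity
  by_cases hex : ∃ b, A b < A z / 2
  · obtain ⟨w, r, hw0, hwr, hlt, hinj, hadj⟩ := aux_walk G hG (fun b => A b < A z / 2) z hex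
    have h1 := aux_drop G w A r hinj hadj
    have h2 := auxA_energy G hd y t
    rw [← hA] at h2
    have h3 : (r : ℝ) * (A z / 2) ≤ (t + 1) * D := by
      rw [← hsum]
      calc (r : ℝ) * (A z / 2) = ∑ i ∈ Finset.range r, (A z / 2) := by simp
        _ ≤ ∑ i ∈ Finset.range r, (G.degree (w i) : ℝ) * A (w i) := by
            apply Finset.sum_le_sum
            intro i hi
            have ha := not_lt.1 (hlt i (Finset.mem_range.1 hi))
            nlinarith [hdeg (w i), hA0 (w i)]
        _ = ∑ u ∈ (Finset.range r).image w, (G.degree u : ℝ) * A u := by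
            rw [Finset.sum_image]
            intro a ha b hb
            exact hinj (by simpa using ha) (by simpa using hb)
        _ ≤ _ := by
            apply Finset.sum_le_sum_of_subset_of_nonneg (Finset.subset_univ _)
            intro u _ _
            exact mul_nonneg (by positivity) (hA0 u)
    have h4 : (A z / 2) ^ 2 ≤ r * (4 * (D * A z)) := by
      calc (A z / 2) ^ 2 ≤ (A (w 0) - A (w r)) ^ 2 := by
            rw [hw0]
            apply pow_le_pow_left₀ (by positivity)
            have : A (w r) < A z / 2 := hwr
            linarith
        _ ≤ _ := h1
        _ ≤ r * (4 * (D * A y)) := by gcongr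
        _ ≤ _ := by
            gcongr
            exact hz y
    have h5 : r * (4 * (D * A z)) ≤ 8 * D * ((t + 1) * D) := by nlinarith
    have h6 : 0 ≤ D ^ 2 * ((t : ℝ) + 1) := by positivity
    nlinarith
  · push Not at hex
    set m : ℝ := (G.edgeFinset.card : ℝ) with hm
    have hdsum : ∑ v, (G.degree v : ℝ) = 2 * m := by
      have := G.sum_degrees_eq_twice_card_edges
      rw [hm]
      exact_mod_cast this
    have hm0 : 0 < m := by
      have := Finset.single_le_sum (f := fun v => (G.degree v : ℝ)) (s := Finset.univ)
        (fun v _ => by positivity) (Finset.mem_univ x)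
      have h1 := hdeg x
      linarith
    have hm1 : 1 ≤ m := by
      rw [hm] at hm0 ⊢
      exact_mod_cast hm0
    have h1 : m * A z ≤ (t + 1) * D := by
      rw [← hsum]
      calc m * A z = ∑ v, (G.degree v : ℝ) * (A z / 2) := by
            rw [← Finset.sum_mul, hdsum]
            ring
        _ ≤ _ := by
            gcongr with v
            exact hex v
    have h2 : (m * A z) ^ 2 ≤ ((t + 1) * D) ^ 2 :=
      pow_le_pow_left₀ (by positivity) h1 2
    have h3 : (t : ℝ) + 1 ≤ 2 * m ^ 2 := by nlinarith
    have h4 : ((t + 1) * D) ^ 2 ≤ m ^ 2 * (2 * D ^ 2 * (t + 1)) := by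
      have : 0 ≤ D ^ 2 * ((t : ℝ) + 1) := by positivity
      nlinarith
    have h5 : m ^ 2 * A z ^ 2 ≤ m ^ 2 * (2 * D ^ 2 * (t + 1)) := by nlinarith
    have h6 := le_of_mul_le_mul_left h5 (by positivity)
    have : 0 ≤ D ^ 2 * ((t : ℝ) + 1) := by positivity
    linarith

end Aux

/-- `Pr(N_t^x(y) ≥ 24·d(y)·√(t+1)) ≤ 1/4` for all `t ≤ β·m²`. -/
theorem statement_3 :
    ∃ β : ℝ, 0 < β ∧
      ∀ (V : Type) [Fintype V] [DecidableEq V] (G : SimpleGraph V) [DecidableRel G.Adj],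
        G.Connected → (∀ v : V, 1 ≤ G.degree v) →
        ∀ x y : V, ∀ t : ℕ,
          (t : ℝ) ≤ β * (G.edgeFinset.card : ℝ) ^ 2 →
          lazyWalkPr G x t
              {f | 24 * (G.degree y : ℝ) * Real.sqrt (t + 1) ≤ (visits y f : ℝ)} ≤ 1 / 4 := by
  refine ⟨1, one_pos, ?_⟩
  intro V _ _ G _ hG hd x y t ht
  rw [one_mul] at ht
  have h1 := aux_markov G x t (fun f => (visits y f : ℝ)) (fun f => by positivity)
    (24 * (G.degree y : ℝ) * Real.sqrt (t + 1))
  rw [aux_exp_visits G hd] at h1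
  have h2 := aux_bound G hG hd y t ht x
  have hD : (1 : ℝ) ≤ (G.degree y : ℝ) := by exact_mod_cast hd y
  have hs : 0 < Real.sqrt ((t : ℝ) + 1) := Real.sqrt_pos.2 (by positivity)
  have hs2 : Real.sqrt ((t : ℝ) + 1) ^ 2 = t + 1 := Real.sq_sqrt (by positivity)
  have h3 : auxA G y t x ≤ 6 * (G.degree y : ℝ) * Real.sqrt (t + 1) := by
    refine (sq_le_sq₀ (auxA_nonneg G y t x) (by positivity)).1 ?_
    rw [mul_pow, hs2]
    linarith
  have hp : 0 < 24 * (G.degree y : ℝ) * Real.sqrt (t + 1) := by positivity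
  refine le_of_mul_le_mul_left (h1.trans ?_) hp
  linarith
end
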